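/- Fix one of the four index pairs (m,k) ∈ {(−1/2,−1),(−1/2,1),(1/2,−1),(1/2,1)} and let u(x) = u⁺(|x|)Φ⁺_{m,k}(θ,φ) + u⁻(|x|)Φ⁻_{m,k}(θ,φ) with u⁺, u⁻ : (0,∞) → ℂ, where (θ,φ) are the spherical angles of x. Then both cubic nonlinearities F₁(u) = ⟨u,u⟩u and F₂(u) = ⟨βu,u⟩u are again of the same form: there exist functions v⁺, v⁻ : (0,∞) → ℂ (explicitly v^± = c·u^± with c(r) = (1/4π)(|u⁺(r)|² + |u⁻(r)|²) for F₁ and c(r) = (1/4π)(|u⁺(r)|² − |u⁻(r)|²) for F₂) such that F(u)(x) = v⁺(|x|)Φ⁺_{m,k}(θ,φ) + v⁻(|x|)Φ⁻_{m,k}(θ,φ). In particular the partial wave subspace spanned by Φ⁺_{m,k} and Φ⁻_{m,k} with radial coefficients is invariant under F₁ and F₂. -/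

import Mathlib

noncomputable section

open MeasureTheory Real Complex Filter Matrix
open scoped FourierTransform ENNReal NNReal

attribute [local instance] Matrix.normedAddCommGroup

/-- Euclidean space `ℝ³`. -/
abbrev R3 : Type := EuclideanSpace ℝ (Fin 3)

/-- Spinors: elements of `ℂ⁴`. -/
abbrev Spinor : Type := Fin 4 → ℂ

/-- The Pauli matrices. -/
def pauli : Fin 3 → Matrix (Fin 2) (Fin 2) ℂ
  | 0 => !![0, 1; 1, 0]
  | 1 => !![0, -Complex.I; Complex.I, 0]
  | 2 => !![1, 0; 0, -1]

/-- The Dirac matrices `αₖ = [[0,σₖ],[σₖ,0]]` in 2×2 block form. -/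
def diracAlpha (k : Fin 3) : Matrix (Fin 4) (Fin 4) ℂ :=
  (Matrix.reindex finSumFinEquiv finSumFinEquiv
    (Matrix.fromBlocks 0 (pauli k) (pauli k) 0) : Matrix (Fin 4) (Fin 4) ℂ)

/-- The Dirac matrix `β = [[I₂,0],[0,−I₂]]`. -/
def diracBeta : Matrix (Fin 4) (Fin 4) ℂ :=
  (Matrix.reindex finSumFinEquiv finSumFinEquiv
    (Matrix.fromBlocks (1 : Matrix (Fin 2) (Fin 2) ℂ) 0 0 (-1 : Matrix (Fin 2) (Fin 2) ℂ)) : Matrix (Fin 4) (Fin 4) ℂ)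

/-- The matrix `γ₅ = [[0,I₂],[I₂,0]]`. -/
def gamma5 : Matrix (Fin 4) (Fin 4) ℂ :=
  (Matrix.reindex finSumFinEquiv finSumFinEquiv
    (Matrix.fromBlocks (0 : Matrix (Fin 2) (Fin 2) ℂ) 1 1 (0 : Matrix (Fin 2) (Fin 2) ℂ)) : Matrix (Fin 4) (Fin 4) ℂ)

/-- `α·a = a₁α₁ + a₂α₂ + a₃α₃` for a real vector `a`. -/
def alphaD (a : Fin 3 → ℝ) : Matrix (Fin 4) (Fin 4) ℂ :=
  ∑ k, (a k : ℂ) • diracAlpha k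

/-- The partial derivative `∂ₖ` of a spinor field. -/
def pd (k : Fin 3) (u : R3 → Spinor) (x : R3) : Spinor :=
  fderiv ℝ u x (EuclideanSpace.single k 1)

/-- The free Dirac operator `𝒟 = −i Σₖ αₖ ∂ₖ`. -/
def diracOp (u : R3 → Spinor) (x : R3) : Spinor :=
  (-Complex.I) • ∑ k, (diracAlpha k).mulVec (pd k u x)

/-- The symbol `cos(t|ξ|)I₄ + i sin(t|ξ|)(α·ξ)/|ξ|` of the free Dirac propagator. -/
def diracSymb (t : ℝ) (ξ : R3) : Matrix (Fin 4) (Fin 4) ℂ :=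
  (Real.cos (t * ‖ξ‖) : ℂ) • 1 +
    (Complex.I * (Real.sin (t * ‖ξ‖) : ℂ) / (‖ξ‖ : ℂ)) • alphaD (fun k => ξ k)

/-- The free Dirac propagator `e^{it𝒟}`, as the Fourier multiplier with matrix symbol
`cos(t|ξ|)I₄ + i sin(t|ξ|)(α·ξ)/|ξ|`. -/
def diracProp (t : ℝ) (f : R3 → Spinor) : R3 → Spinor :=
  𝓕⁻ fun ξ => (diracSymb t ξ).mulVec (𝓕 f ξ)

/-- The homogeneous Sobolev norm `‖f‖_{Ḣˢ} = ‖ |ξ|ˢ f̂(ξ) ‖_{L²}`. -/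
def hSob (s : ℝ) (f : R3 → Spinor) : ℝ≥0∞ :=
  eLpNorm (fun ξ : R3 => ‖ξ‖ ^ s • 𝓕 f ξ) 2 volume

/-- The mixed norm `‖u‖_{L²_t L^∞_x}`. -/
def L2Linf (u : ℝ → R3 → Spinor) : ℝ≥0∞ :=
  (∫⁻ t : ℝ, (eLpNorm (u t) ⊤ volume) ^ 2) ^ (1/2 : ℝ)

/-- The mixed norm `‖u‖_{L²_t L²_x}`. -/
def L2L2 (u : ℝ → R3 → Spinor) : ℝ≥0∞ :=
  (∫⁻ t : ℝ, (eLpNorm (u t) 2 volume) ^ 2) ^ (1/2 : ℝ)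

/-- A function on `ℝ³` is radial if it depends only on `|x|`. -/
def IsRadial {E : Type*} (f : R3 → E) : Prop :=
  ∀ x y : R3, ‖x‖ = ‖y‖ → f x = f y

/-- The class `𝓗̇¹`: `f = f₁ + 𝒟f₂` with `f₁ ∈ Ḣ¹`, `f₂ ∈ Ḣ²`, componentwise radial. -/
def Hclass (f : R3 → Spinor) : Prop :=
  ∃ f₁ f₂ : R3 → Spinor,
    (∀ j, IsRadial fun x => f₁ x j) ∧ (∀ j, IsRadial fun x => f₂ x j) ∧
    hSob 1 f₁ < ⊤ ∧ hSob 2 f₂ < ⊤ ∧ f = f₁ + fun x => diracOp f₂ x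

/-- The potential `V(x) = V₁(|x|)I₄ + iβ(α·x̂)V₂(|x|)`. -/
def potential (V₁ V₂ : ℝ → ℝ) (x : R3) : Matrix (Fin 4) (Fin 4) ℂ :=
  (V₁ ‖x‖ : ℂ) • 1 +
    (Complex.I * (V₂ ‖x‖ : ℂ)) • (diracBeta * alphaD fun k => ‖x‖⁻¹ * x k)

/-- The size assumption `|V(x)| ≤ δ/(|x|^{1/2}|log|x||^{σ/2} + |x|^σ)`. -/
def VBound (σ δ : ℝ) (V : R3 → Matrix (Fin 4) (Fin 4) ℂ) : Prop :=
  ∀ x : R3, x ≠ 0 →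
    ‖V x‖ ≤ δ / (‖x‖ ^ (1/2 : ℝ) * |Real.log ‖x‖| ^ (σ/2) + ‖x‖ ^ σ)


/-- `e^{iφ} sin θ` of the spherical angles of `x`, i.e. `(x₁ + i x₂)/|x|`. -/
def eSin (x : R3) : ℂ := ((x 0 : ℂ) + (x 1 : ℂ) * Complex.I) / (‖x‖ : ℂ)

/-- `cos θ` of the spherical angles of `x`, i.e. `x₃/|x|`. -/
def cosTheta (x : R3) : ℂ := ((x 2 / ‖x‖ : ℝ) : ℂ)

/-- The four admissible index pairs `(m,k)` with `j = 1/2`. -/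
def fourPairs : Set (ℝ × ℝ) := {(-1/2, -1), (-1/2, 1), (1/2, -1), (1/2, 1)}

/-- The spinors `Φ⁺_{m,k}`, viewed as functions of `x ∈ ℝ³ ∖ {0}` through the spherical
angles of `x`. -/
def PhiP (m k : ℝ) (x : R3) : Spinor :=
  ((2 * Real.sqrt π : ℝ) : ℂ)⁻¹ •
    (if m = -1/2 ∧ k = -1 then ![0, Complex.I, 0, 0]
     else if m = -1/2 ∧ k = 1 then ![Complex.I * eSin x, -(Complex.I * cosTheta x), 0, 0]
     else if m = 1/2 ∧ k = -1 then ![Complex.I, 0, 0, 0]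
     else ![Complex.I * cosTheta x, Complex.I * eSin x, 0, 0])

/-- The spinors `Φ⁻_{m,k}`, viewed as functions of `x ∈ ℝ³ ∖ {0}` through the spherical
angles of `x`. -/
def PhiM (m k : ℝ) (x : R3) : Spinor :=
  ((2 * Real.sqrt π : ℝ) : ℂ)⁻¹ •
    (if m = -1/2 ∧ k = -1 then ![0, 0, eSin x, -(cosTheta x)]
     else if m = -1/2 ∧ k = 1 then ![0, 0, 0, 1]
     else if m = 1/2 ∧ k = -1 then ![0, 0, cosTheta x, eSin x]
     else ![0, 0, 1, 0])

/-- The hermitian product on `ℂ⁴`: `⟨a,b⟩ = Σⱼ conj(aⱼ) bⱼ`. -/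
def herm (a b : Spinor) : ℂ := ∑ j, (starRingEnd ℂ) (a j) * b j

/-- `|e^{iφ} sin θ|² + |cos θ|² = 1`. -/
lemma conj_eSin_mul_add_conj_cosTheta_mul {x : R3} (hx : x ≠ 0) :
    (starRingEnd ℂ) (eSin x) * eSin x + (starRingEnd ℂ) (cosTheta x) * cosTheta x = 1 := by
  have hn : (‖x‖ : ℂ) ≠ 0 := by exact_mod_cast norm_ne_zero_iff.mpr hx
  have hsq : (‖x‖ : ℂ) ^ 2 = (x 0 : ℂ) ^ 2 + (x 1 : ℂ) ^ 2 + (x 2 : ℂ) ^ 2 := by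
    have := EuclideanSpace.real_norm_sq_eq x
    rw [Fin.sum_univ_three] at this
    exact_mod_cast this
  simp only [eSin, cosTheta, map_div₀, map_add, map_mul, Complex.conj_ofReal, Complex.conj_I,
    Complex.ofReal_div]
  field_simp
  linear_combination -hsq - (x 1 : ℂ) ^ 2 * Complex.I_sq

lemma conj_normalization_mul :
    (starRingEnd ℂ) ((2 * Real.sqrt π : ℝ) : ℂ)⁻¹ * ((2 * Real.sqrt π : ℝ) : ℂ)⁻¹ =
      ((1 / (4 * π) : ℝ) : ℂ) := by
  rw [map_inv₀, Complex.conj_ofReal, ← mul_inv, ← Complex.ofReal_mul, ← Complex.ofReal_inv,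
    mul_mul_mul_comm, Real.mul_self_sqrt Real.pi_pos.le]
  norm_num

lemma herm_smul_smul (a : ℂ) (u v : Spinor) :
    herm (a • u) (a • v) = (starRingEnd ℂ) a * a * herm u v := by
  simp only [herm, Finset.mul_sum, Pi.smul_apply, smul_eq_mul, map_mul]
  exact Finset.sum_congr rfl fun j _ => by ring

lemma herm_vec_self (a b c d : ℂ) :
    herm ![a, b, c, d] ![a, b, c, d] = (starRingEnd ℂ) a * a + (starRingEnd ℂ) b * b +
      (starRingEnd ℂ) c * c + (starRingEnd ℂ) d * d :=
  Fin.sum_univ_four _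

lemma herm_PhiP_self {m k : ℝ} (h : (m, k) ∈ fourPairs) {x : R3} (hx : x ≠ 0) :
    herm (PhiP m k x) (PhiP m k x) = ((1 / (4 * π) : ℝ) : ℂ) := by
  have hang := conj_eSin_mul_add_conj_cosTheta_mul hx
  rw [PhiP, herm_smul_smul, conj_normalization_mul]
  refine mul_eq_left₀ ?_ |>.mpr ?_
  · exact_mod_cast (by positivity : 1 / (4 * π) ≠ 0)
  simp only [fourPairs, Set.mem_insert_iff, Set.mem_singleton_iff, Prod.mk.injEq] at h
  rcases h with ⟨rfl, rfl⟩ | ⟨rfl, rfl⟩ | ⟨rfl, rfl⟩ | ⟨rfl, rfl⟩ <;>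
    norm_num [herm_vec_self] <;>
    linear_combination hang - ((starRingEnd ℂ) (eSin x) * eSin x +
      (starRingEnd ℂ) (cosTheta x) * cosTheta x) * Complex.I_sq

lemma herm_PhiM_self {m k : ℝ} (h : (m, k) ∈ fourPairs) {x : R3} (hx : x ≠ 0) :
    herm (PhiM m k x) (PhiM m k x) = ((1 / (4 * π) : ℝ) : ℂ) := by
  have hang := conj_eSin_mul_add_conj_cosTheta_mul hx
  rw [PhiM, herm_smul_smul, conj_normalization_mul]
  refine mul_eq_left₀ ?_ |>.mpr ?_
  · exact_mod_cast (by positivity : 1 / (4 * π) ≠ 0)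
  simp only [fourPairs, Set.mem_insert_iff, Set.mem_singleton_iff, Prod.mk.injEq] at h
  rcases h with ⟨rfl, rfl⟩ | ⟨rfl, rfl⟩ | ⟨rfl, rfl⟩ | ⟨rfl, rfl⟩ <;>
    norm_num [herm_vec_self] <;>
    linear_combination hang

lemma PhiP_lower (m k : ℝ) (x : R3) : PhiP m k x 2 = 0 ∧ PhiP m k x 3 = 0 := by
  unfold PhiP
  split_ifs <;> simp

lemma PhiM_upper (m k : ℝ) (x : R3) : PhiM m k x 0 = 0 ∧ PhiM m k x 1 = 0 := by
  unfold PhiM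
  split_ifs <;> simp

lemma diracBeta_eq_diagonal : diracBeta = Matrix.diagonal ![1, 1, -1, -1] := by
  ext i j
  fin_cases i <;> fin_cases j <;> first | rfl | exact neg_zero

/-- The hermitian square of a spinor whose components `a • P` and `b • M` are supported in the
upper and the lower block respectively. -/
lemma herm_self_of_blocks {P M : Spinor} (hP : P 2 = 0 ∧ P 3 = 0) (hM : M 0 = 0 ∧ M 1 = 0)
    (a b : ℂ) :
    herm (a • P + b • M) (a • P + b • M) =
      (‖a‖ : ℂ) ^ 2 * herm P P + (‖b‖ : ℂ) ^ 2 * herm M M := by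
  simp only [herm, Fin.sum_univ_four, Pi.add_apply, Pi.smul_apply, smul_eq_mul, hP.1, hP.2,
    hM.1, hM.2, ← Complex.conj_mul', map_add, map_mul, map_zero]
  ring

lemma herm_diracBeta_self_of_blocks {P M : Spinor} (hP : P 2 = 0 ∧ P 3 = 0)
    (hM : M 0 = 0 ∧ M 1 = 0) (a b : ℂ) :
    herm (diracBeta.mulVec (a • P + b • M)) (a • P + b • M) =
      (‖a‖ : ℂ) ^ 2 * herm P P - (‖b‖ : ℂ) ^ 2 * herm M M := by
  simp [herm, Fin.sum_univ_four, diracBeta_eq_diagonal, Matrix.mulVec_diagonal, hP.1, hP.2,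
    hM.1, hM.2, ← Complex.conj_mul']
  ring

/-- The partial wave subspaces with `j = 1/2` are invariant under the
cubic nonlinearities `F₁(u) = ⟨u,u⟩u` and `F₂(u) = ⟨βu,u⟩u`, with explicit radial
coefficients. -/
theorem cubic_nonlinearity_invariance (m k : ℝ) (h : (m, k) ∈ fourPairs)
    (up um : ℝ → ℂ) (x : R3) (hx : x ≠ 0) :
    (herm (up ‖x‖ • PhiP m k x + um ‖x‖ • PhiM m k x)
          (up ‖x‖ • PhiP m k x + um ‖x‖ • PhiM m k x) •
        (up ‖x‖ • PhiP m k x + um ‖x‖ • PhiM m k x) =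
      (((1 / (4 * π) * (‖up ‖x‖‖ ^ 2 + ‖um ‖x‖‖ ^ 2) : ℝ) : ℂ) * up ‖x‖) • PhiP m k x +
        (((1 / (4 * π) * (‖up ‖x‖‖ ^ 2 + ‖um ‖x‖‖ ^ 2) : ℝ) : ℂ) * um ‖x‖) • PhiM m k x) ∧
    (herm (diracBeta.mulVec (up ‖x‖ • PhiP m k x + um ‖x‖ • PhiM m k x))
          (up ‖x‖ • PhiP m k x + um ‖x‖ • PhiM m k x) •
        (up ‖x‖ • PhiP m k x + um ‖x‖ • PhiM m k x) =
      (((1 / (4 * π) * (‖up ‖x‖‖ ^ 2 - ‖um ‖x‖‖ ^ 2) : ℝ) : ℂ) * up ‖x‖) • PhiP m k x +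
        (((1 / (4 * π) * (‖up ‖x‖‖ ^ 2 - ‖um ‖x‖‖ ^ 2) : ℝ) : ℂ) * um ‖x‖) • PhiM m k x) := by
  have hP := herm_PhiP_self h hx
  have hM := herm_PhiM_self h hx
  rw [herm_self_of_blocks (PhiP_lower m k x) (PhiM_upper m k x),
    herm_diracBeta_self_of_blocks (PhiP_lower m k x) (PhiM_upper m k x), hP, hM]
  constructor <;>
  · rw [smul_add, smul_smul, smul_smul]
    push_cast
    congr 2 <;> ring
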